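/- arXiv:2604.10276 — 3 statements merged into one kernel-verified Lean document; each statement's English description precedes it below -/
import Mathlib

section
/- For every n ≥ 4, the double Geronimus polynomials satisfy the five-term recurrence (x−a)² P_n^{gg}(x) = P_{n+2}^{gg}(x) + α_{n+1,n+1} P_{n+1}^{gg}(x) + α_{n+1,n} P_n^{gg}(x) + α_{n+1,n−1} P_{n−1}^{gg}(x) + α_{n+1,n−2} P_{n−2}^{gg}(x), where α_{n+1,n+1} = (C_{n+1} B_n ‖P_{n−1}‖₀² + B_{n+1} ‖P_n‖₀²)/(C_{n+1} ‖P_{n−1}‖₀²), α_{n+1,n} = (‖P_n‖₀² + B_n² ‖P_{n−1}‖₀² + C_n² ‖P_{n−2}‖₀²)/(C_n ‖P_{n−2}‖₀²), α_{n+1,n−1} = (B_n ‖P_{n−1}‖₀² + B_{n−1} C_n ‖P_{n−2}‖₀²)/(C_{n−1} ‖P_{n−3}‖₀²), and α_{n+1,n−2} = C_n ‖P_{n−2}‖₀²/(C_{n−2} ‖P_{n−4}‖₀²). -/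
open MeasureTheory Polynomial Matrix

/-- A linear functional that kills the first `N` terms of a monic polynomial sequence, one in each
degree, kills every polynomial of degree less than `N`. -/
theorem linearMap_eq_zero_of_degree_lt {R M : Type*} [CommRing R] [Nontrivial R]
    [AddCommGroup M] [Module R M] {G : ℕ → R[X]} (hG : ∀ n, (G n).Monic)
    (hdeg : ∀ n, (G n).natDegree = n) (f : R[X] →ₗ[R] M) (N : ℕ) (hf : ∀ k < N, f (G k) = 0)
    (q : R[X]) (hq : q.degree < N) : f q = 0 := by
  induction N generalizing q with
  | zero =>
    have : q = 0 := by simpa [Polynomial.degree_lt_iff_coeff_zero, Polynomial.ext_iff] using hq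
    simp [this]
  | succ N ih =>
    have hlow : (q - q.coeff N • G N).degree < N := by
      rw [Polynomial.degree_lt_iff_coeff_zero] at hq ⊢
      intro m hm
      rcases hm.eq_or_lt with rfl | hm
      · have h : (G N).coeff N = 1 := by simpa [hdeg] using (hG N).coeff_natDegree
        simp [h]
      · have h : (G N).coeff m = 0 := Polynomial.coeff_eq_zero_of_natDegree_lt (by simpa [hdeg])
        simp [h, hq m hm]
    have h := ih (fun k hk => hf k (by omega)) _ hlow
    rwa [map_sub, map_smul, hf N (by omega), smul_zero, sub_zero] at h

/-- The norms of a monic sequence orthogonal for `S`, when multiplication by `(X - a) ^ 2` carries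
`S` into `L` and the sequence is a three-term combination of an `L`-orthogonal one. -/
theorem orthogonal_norm_eq_of_connection {S L : LinearMap.BilinForm ℝ ℝ[X]} {a : ℝ}
    {P G : ℕ → ℝ[X]} {nrm B C' : ℕ → ℝ}
    (hSL : ∀ p q, S p ((X - C a) ^ 2 * q) = L p q)
    (hPmonic : ∀ n, (P n).Monic) (hPdeg : ∀ n, (P n).natDegree = n)
    (hL : ∀ m n, L (P m) (P n) = if m = n then nrm m else 0)
    (hGmonic : ∀ n, (G n).Monic) (hGdeg : ∀ n, (G n).natDegree = n)
    (hGorth : ∀ m n, m ≠ n → S (G m) (G n) = 0)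
    (hconn : ∀ n, G (n + 2) = P (n + 2) + B (n + 2) • P (n + 1) + C' (n + 2) • P n) (n : ℕ) :
    S (G (n + 2)) (G (n + 2)) = C' (n + 2) * nrm n := by
  have hmonic : ((X - C a) ^ 2 * P n).Monic := ((monic_X_sub_C a).pow 2).mul (hPmonic n)
  have hdeg : ((X - C a) ^ 2 * P n).natDegree = n + 2 := by
    rw [((monic_X_sub_C a).pow 2).natDegree_mul (hPmonic n), (monic_X_sub_C a).natDegree_pow,
      natDegree_X_sub_C, hPdeg]
    omega
  have hlt : ((X - C a) ^ 2 * P n - G (n + 2)).degree < ((n + 2 : ℕ) : WithBot ℕ) := by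
    have hd : ((X - C a) ^ 2 * P n).degree = ((n + 2 : ℕ) : WithBot ℕ) := by
      rw [degree_eq_natDegree hmonic.ne_zero, hdeg]
    rw [← hd]
    refine degree_sub_lt_left ?_ hmonic.ne_zero (by rw [hmonic.leadingCoeff, (hGmonic _).leadingCoeff])
    rw [hd, degree_eq_natDegree (hGmonic _).ne_zero, hGdeg]
  have h := linearMap_eq_zero_of_degree_lt hGmonic hGdeg (S (G (n + 2))) (n + 2)
    (fun k hk => hGorth _ _ (by omega)) _ hlt
  rw [map_sub, hSL, sub_eq_zero] at h
  rw [← h, hconn]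
  simp [hL]

/-- The five-term recurrence for abstract bilinear forms `S` and `L`, the second obtained from the
first by inserting the factor `(X - a) ^ 2`. -/
theorem five_term_recurrence_of_connection {S L : LinearMap.BilinForm ℝ ℝ[X]} {a : ℝ}
    {P G : ℕ → ℝ[X]} {nrm B C' : ℕ → ℝ}
    (hSL : ∀ p q, S p ((X - C a) ^ 2 * q) = L p q) (hSpos : ∀ p ≠ 0, 0 < S p p)
    (hPmonic : ∀ n, (P n).Monic) (hPdeg : ∀ n, (P n).natDegree = n)
    (hL : ∀ m n, L (P m) (P n) = if m = n then nrm m else 0) (hnrm : ∀ n, nrm n ≠ 0)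
    (hGmonic : ∀ n, (G n).Monic) (hGdeg : ∀ n, (G n).natDegree = n)
    (hGorth : ∀ m n, m ≠ n → S (G m) (G n) = 0)
    (hconn1 : G 1 = P 1 + B 1 • P 0)
    (hconn : ∀ n, G (n + 2) = P (n + 2) + B (n + 2) • P (n + 1) + C' (n + 2) • P n)
    (hC' : ∀ n, C' (n + 2) ≠ 0) (n : ℕ) :
    (X - C a) ^ 2 * G (n + 4) = G (n + 6)
      + ((C' (n + 5) * B (n + 4) * nrm (n + 3) + B (n + 5) * nrm (n + 4))
          / (C' (n + 5) * nrm (n + 3))) • G (n + 5)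
      + ((nrm (n + 4) + B (n + 4) ^ 2 * nrm (n + 3) + C' (n + 4) ^ 2 * nrm (n + 2))
          / (C' (n + 4) * nrm (n + 2))) • G (n + 4)
      + ((B (n + 4) * nrm (n + 3) + B (n + 3) * C' (n + 4) * nrm (n + 2))
          / (C' (n + 3) * nrm (n + 1))) • G (n + 3)
      + (C' (n + 4) * nrm (n + 2) / (C' (n + 2) * nrm n)) • G (n + 2) := by
  have hS : ∀ m k, S (G m) (G (k + 2)) = if m = k + 2 then C' (k + 2) * nrm k else 0 := by
    intro m k
    split_ifs with h
    · rw [h]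
      exact orthogonal_norm_eq_of_connection hSL hPmonic hPdeg hL hGmonic hGdeg hGorth hconn k
    · exact hGorth _ _ h
  have hG0 : G 0 = P 0 := by
    rw [(hGmonic 0).natDegree_eq_zero.mp (hGdeg 0), (hPmonic 0).natDegree_eq_zero.mp (hPdeg 0)]
  rw [← sub_eq_zero]
  set D : ℝ[X] := _ - _ with hD
  have horth : ∀ k, S (G k) D = 0 := by
    intro k
    rw [hD, map_sub, hSL, sub_eq_zero]
    simp only [map_add, map_smul, smul_eq_mul, hS]
    rcases k with _ | _ | k
    · rw [hG0, hconn]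
      simp [hL]
    · rw [hconn1, hconn]
      simp [hL]
    · rw [hconn k, hconn (n + 2)]
      simp only [map_add, map_smul, LinearMap.add_apply, LinearMap.smul_apply, smul_eq_mul, hL]
      have h0 := hnrm n
      have h1 := hnrm (n + 1)
      have h2 := hnrm (n + 2)
      have h3 := hnrm (n + 3)
      have c2 := hC' n
      have c3 : C' (n + 3) ≠ 0 := hC' (n + 1)
      have c4 : C' (n + 4) ≠ 0 := hC' (n + 2)
      have c5 : C' (n + 5) ≠ 0 := hC' (n + 3)
      by_cases hk : n ≤ k ∧ k ≤ n + 4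
      · obtain rfl | rfl | rfl | rfl | rfl :
          k = n ∨ k = n + 1 ∨ k = n + 2 ∨ k = n + 3 ∨ k = n + 4 := by omega
        all_goals
          simp [add_assoc]
          try field_simp
          try ring
      · repeat rw [if_neg (by omega)]
        simp
  by_contra hne
  refine (hSpos D hne).ne' ?_
  exact linearMap_eq_zero_of_degree_lt hGmonic hGdeg (S.flip D) (D.natDegree + 1)
    (fun k _ => horth k) D
    (degree_le_natDegree.trans_lt (by exact_mod_cast Nat.lt_succ_self _))

theorem double_geronimus_five_term_recurrence
    (μ μgg : MeasureTheory.Measure ℝ) (E : Set ℝ) (a : ℝ)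
    (hEc : IsCompact E) (hEinf : E.Infinite) (haE : a ∉ E) (hEsupp : μ Eᶜ = 0)
    (hμint : ∀ p : ℝ[X], MeasureTheory.Integrable (fun x => p.eval x) μ)
    (hμpos : ∀ p : ℝ[X], p ≠ 0 → 0 < ∫ x, (p.eval x) ^ 2 ∂μ)
    (P : ℕ → ℝ[X])
    (hPmonic : ∀ n, (P n).Monic)
    (hPdeg : ∀ n, (P n).natDegree = n)
    (hPorth : ∀ m n, m ≠ n → ∫ x, (P m).eval x * (P n).eval x ∂μ = 0)
    (nrm : ℕ → ℝ) (hnrm : ∀ k, nrm k = ∫ x, ((P k).eval x) ^ 2 ∂μ)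
    (hμggint : ∀ p : ℝ[X], MeasureTheory.Integrable (fun x => p.eval x) μgg)
    (hμgg : ∀ p : ℝ[X], ∫ x, p.eval x * (x - a) ^ 2 ∂μgg = ∫ x, p.eval x ∂μ)
    (M₁ : Matrix (Fin 2) (Fin 2) ℝ) (hM₁ : M₁.IsSymm)
    (inn : ℝ[X] → ℝ[X] → ℝ)
    (hinn : ∀ p q : ℝ[X], inn p q = (∫ x, p.eval x * q.eval x ∂μgg)
      + ![p.eval a, (derivative p).eval a] ⬝ᵥ
          M₁.mulVec ![q.eval a, (derivative q).eval a])
    (hinnpos : ∀ p : ℝ[X], p ≠ 0 → 0 < inn p p)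
    (Pgg : ℕ → ℝ[X])
    (hGmonic : ∀ n, (Pgg n).Monic)
    (hGdeg : ∀ n, (Pgg n).natDegree = n)
    (hGorth : ∀ m n, m ≠ n → inn (Pgg m) (Pgg n) = 0)
    (B C' : ℕ → ℝ)
    (hconn1 : Pgg 1 = P 1 + Polynomial.C (B 1) * P 0)
    (hconn : ∀ n, 2 ≤ n →
      Pgg n = P n + Polynomial.C (B n) * P (n - 1) + Polynomial.C (C' n) * P (n - 2))
    (hC' : ∀ n, 2 ≤ n → C' n ≠ 0)
    : ∀ n, 4 ≤ n →
      (X - Polynomial.C a) ^ 2 * Pgg n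
        = Pgg (n + 2)
          + Polynomial.C ((C' (n + 1) * B n * nrm (n - 1) + B (n + 1) * nrm n)
              / (C' (n + 1) * nrm (n - 1))) * Pgg (n + 1)
          + Polynomial.C ((nrm n + (B n) ^ 2 * nrm (n - 1) + (C' n) ^ 2 * nrm (n - 2))
              / (C' n * nrm (n - 2))) * Pgg n
          + Polynomial.C ((B n * nrm (n - 1) + B (n - 1) * C' n * nrm (n - 2))
              / (C' (n - 1) * nrm (n - 3))) * Pgg (n - 1)
          + Polynomial.C (C' n * nrm (n - 2) / (C' (n - 2) * nrm (n - 4))) * Pgg (n - 2) := by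
  have hprod (ν : Measure ℝ) (hν : ∀ p : ℝ[X], Integrable (fun x => p.eval x) ν) (p q : ℝ[X]) :
      Integrable (fun x => p.eval x * q.eval x) ν := by simpa using hν (p * q)
  let L : LinearMap.BilinForm ℝ ℝ[X] := LinearMap.mk₂ ℝ
    (fun p q => ∫ x, p.eval x * q.eval x ∂μ)
    (fun p q r => by
      simp only [eval_add, add_mul]
      exact integral_add (hprod μ hμint p r) (hprod μ hμint q r))
    (fun c p q => by simp only [eval_smul, smul_eq_mul, mul_assoc, integral_const_mul])
    (fun p q r => by
      simp only [eval_add, mul_add]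
      exact integral_add (hprod μ hμint p q) (hprod μ hμint p r))
    (fun c p q => by
      simp only [eval_smul, smul_eq_mul, mul_left_comm _ c, integral_const_mul])
  let S : LinearMap.BilinForm ℝ ℝ[X] := LinearMap.mk₂ ℝ inn
    (fun p q r => by
      simp only [hinn, eval_add, add_mul, derivative_add]
      rw [integral_add (hprod μgg hμggint p r) (hprod μgg hμggint q r)]
      simp [dotProduct, mulVec, Fin.sum_univ_two]
      ring)
    (fun c p q => by
      simp only [hinn, eval_smul, smul_eq_mul, mul_assoc, integral_const_mul, derivative_smul]
      simp [dotProduct, mulVec, Fin.sum_univ_two]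
      ring)
    (fun p q r => by
      simp only [hinn, eval_add, mul_add, derivative_add]
      rw [integral_add (hprod μgg hμggint p q) (hprod μgg hμggint p r)]
      simp [dotProduct, mulVec, Fin.sum_univ_two]
      ring)
    (fun c p q => by
      simp only [hinn, eval_smul, smul_eq_mul, mul_left_comm _ c, integral_const_mul,
        derivative_smul]
      simp [dotProduct, mulVec, Fin.sum_univ_two]
      ring)
  have hSL : ∀ p q, S p ((X - C a) ^ 2 * q) = L p q := by
    intro p q
    have h := hμgg (p * q)
    simp only [eval_mul] at h
    simp only [S, L, LinearMap.mk₂_apply, hinn, ← h]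
    simp [dotProduct, mulVec, Fin.sum_univ_two, derivative_mul, derivative_pow]
    congr 1 with x
    ring
  have hL : ∀ m n, L (P m) (P n) = if m = n then nrm m else 0 := by
    intro m n
    split_ifs with h
    · subst h
      simp [L, hnrm, sq]
    · exact hPorth m n h
  intro n hn
  obtain ⟨m, rfl⟩ := Nat.exists_eq_add_of_le' hn
  simp only [← smul_eq_C_mul]
  refine five_term_recurrence_of_connection hSL hinnpos hPmonic hPdeg hL
    (fun k => ?_) hGmonic hGdeg hGorth (by rw [hconn1, smul_eq_C_mul]) (fun k => ?_)
    (fun k => hC' _ (by omega)) m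
  · rw [hnrm]
    exact (hμpos _ (hPmonic k).ne_zero).ne'
  · simpa [smul_eq_C_mul] using hconn (k + 2) (by omega)
end

section
/- For α > −1, β > 1 and every n ≥ 1, the monic Jacobi polynomials satisfy (1+x)² P_n^{(α,β)}(x) = P_{n+2}^{(α,β−2)}(x) + [4(n+β)(n+α+β)/((2n+α+β)(2n+α+β+2))] P_{n+1}^{(α,β−2)}(x) + [4(n+β−1)(n+β)(n+α+β−1)(n+α+β)/((2n+α+β−1)(2n+α+β)²(2n+α+β+1))] P_n^{(α,β−2)}(x). -/
open MeasureTheory Polynomial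

/-- The weight `(1 - x) ^ a * (1 + x) ^ b` on `(-1, 1)`. -/
noncomputable def jacobiWeight (a b x : ℝ) : ℝ := (1 - x) ^ a * (1 + x) ^ b

/-- The integral of a polynomial against the Jacobi weight. -/
noncomputable def jacobiIntegral (a b : ℝ) (p : ℝ[X]) : ℝ :=
  ∫ x in Set.Ioo (-1 : ℝ) 1, p.eval x * jacobiWeight a b x

lemma jacobiWeight_pos (a b : ℝ) {x : ℝ} (hx : x ∈ Set.Ioo (-1 : ℝ) 1) :
    0 < jacobiWeight a b x :=
  mul_pos (Real.rpow_pos_of_pos (by linarith [hx.2]) _)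
    (Real.rpow_pos_of_pos (by linarith [hx.1]) _)

lemma intervalIntegrable_jacobiWeight {a b : ℝ} (ha : -1 < a) (hb : -1 < b) :
    IntervalIntegrable (jacobiWeight a b) volume (-1) 1 := by
  have h1 : IntervalIntegrable (fun x : ℝ => (1 - x) ^ a) volume 0 1 := by
    have := (intervalIntegral.intervalIntegrable_rpow' (a := 1) (b := 0) ha).comp_sub_left 1
    simpa using this
  have h2 : IntervalIntegrable (fun x : ℝ => (1 + x) ^ b) volume (-1) 0 := by
    have := (intervalIntegral.intervalIntegrable_rpow' (a := 0) (b := 1) hb).comp_add_left 1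
    simpa using this
  have h3 : IntervalIntegrable (jacobiWeight a b) volume 0 1 := by
    refine h1.mul_continuousOn ?_
    rw [Set.uIcc_of_le zero_le_one]
    refine ContinuousOn.rpow_const (by fun_prop) fun x hx => Or.inl ?_
    linarith [hx.1]
  have h4 : IntervalIntegrable (jacobiWeight a b) volume (-1) 0 := by
    refine h2.continuousOn_mul ?_
    rw [Set.uIcc_of_le (by norm_num)]
    refine ContinuousOn.rpow_const (by fun_prop) fun x hx => Or.inl ?_
    linarith [hx.2]
  exact h4.trans h3

lemma intervalIntegrable_eval_mul_jacobiWeight {a b : ℝ} (ha : -1 < a) (hb : -1 < b) (p : ℝ[X]) :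
    IntervalIntegrable (fun x => p.eval x * jacobiWeight a b x) volume (-1) 1 :=
  (intervalIntegrable_jacobiWeight ha hb).continuousOn_mul p.continuous.continuousOn

lemma integrableOn_eval_mul_jacobiWeight {a b : ℝ} (ha : -1 < a) (hb : -1 < b) (p : ℝ[X]) :
    IntegrableOn (fun x => p.eval x * jacobiWeight a b x) (Set.Ioo (-1 : ℝ) 1) :=
  (intervalIntegrable_iff_integrableOn_Ioo_of_le (by norm_num)).1
    (intervalIntegrable_eval_mul_jacobiWeight ha hb p)

lemma jacobiIntegral_add {a b : ℝ} (ha : -1 < a) (hb : -1 < b) (p q : ℝ[X]) :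
    jacobiIntegral a b (p + q) = jacobiIntegral a b p + jacobiIntegral a b q := by
  unfold jacobiIntegral
  rw [← integral_add (integrableOn_eval_mul_jacobiWeight ha hb p)
    (integrableOn_eval_mul_jacobiWeight ha hb q)]
  simp [add_mul]

lemma jacobiIntegral_C_mul (a b c : ℝ) (p : ℝ[X]) :
    jacobiIntegral a b (C c * p) = c * jacobiIntegral a b p := by
  unfold jacobiIntegral
  rw [← integral_const_mul]
  simp [mul_assoc]

lemma jacobiIntegral_sum {a b : ℝ} (ha : -1 < a) (hb : -1 < b) {ι : Type*} (s : Finset ι)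
    (f : ι → ℝ[X]) :
    jacobiIntegral a b (∑ i ∈ s, f i) = ∑ i ∈ s, jacobiIntegral a b (f i) := by
  unfold jacobiIntegral
  rw [← integral_finsetSum s fun i _ => integrableOn_eval_mul_jacobiWeight ha hb (f i)]
  simp [eval_finsetSum, Finset.sum_mul]

lemma jacobiIntegral_one_add_X_mul (a b : ℝ) (p : ℝ[X]) :
    jacobiIntegral a b ((1 + X) * p) = jacobiIntegral a (b + 1) p := by
  refine setIntegral_congr_fun measurableSet_Ioo fun x hx => ?_
  have h : 0 < 1 + x := by linarith [hx.1]
  simp only [jacobiWeight, Real.rpow_add_one h.ne', eval_mul, eval_add, eval_one, eval_X]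
  ring

lemma jacobiIntegral_one_sub_X_mul (a b : ℝ) (p : ℝ[X]) :
    jacobiIntegral a b ((1 - X) * p) = jacobiIntegral (a + 1) b p := by
  refine setIntegral_congr_fun measurableSet_Ioo fun x hx => ?_
  have h : 0 < 1 - x := by linarith [hx.2]
  simp only [jacobiWeight, Real.rpow_add_one h.ne', eval_mul, eval_sub, eval_one, eval_X]
  ring

/-- The derivative of `jacobiWeight (a + 1) (b + 1)` divided by `jacobiWeight a b`. -/
noncomputable def pearsonPoly (a b : ℝ) : ℝ[X] := C (b + 1) * (1 - X) - C (a + 1) * (1 + X)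

lemma jacobiIntegral_pearson {a b : ℝ} (ha : -1 < a) (hb : -1 < b) (g : ℝ[X]) :
    jacobiIntegral a b ((1 - X) * (1 + X) * derivative g + pearsonPoly a b * g) = 0 := by
  have hderiv : ∀ x ∈ Set.Ioo (-1 : ℝ) 1,
      HasDerivAt (fun x => g.eval x * jacobiWeight (a + 1) (b + 1) x)
        (((1 - X) * (1 + X) * derivative g + pearsonPoly a b * g).eval x
          * jacobiWeight a b x) x := by
    intro x hx
    have h1 : 0 < 1 - x := by linarith [hx.2]
    have h2 : 0 < 1 + x := by linarith [hx.1]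
    have d1 := ((hasDerivAt_id x).const_sub 1).rpow_const (p := a + 1) (Or.inl h1.ne')
    have d2 := ((hasDerivAt_id x).const_add 1).rpow_const (p := b + 1) (Or.inl h2.ne')
    refine ((g.hasDerivAt x).mul (d1.mul d2)).congr_deriv ?_
    simp only [jacobiWeight, pearsonPoly, id, Pi.mul_apply, Real.rpow_add_one h1.ne',
      Real.rpow_add_one h2.ne', add_sub_cancel_right, eval_mul, eval_add, eval_sub, eval_one,
      eval_X, eval_C]
    ring
  have hcont : ContinuousOn (fun x => g.eval x * jacobiWeight (a + 1) (b + 1) x)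
      (Set.Icc (-1 : ℝ) 1) := by
    refine g.continuous.continuousOn.mul (ContinuousOn.mul ?_ ?_)
    · exact ContinuousOn.rpow_const (by fun_prop) fun _ _ => Or.inr (by linarith)
    · exact ContinuousOn.rpow_const (by fun_prop) fun _ _ => Or.inr (by linarith)
  have h := intervalIntegral.integral_eq_sub_of_hasDerivAt_of_le (by norm_num) hcont hderiv
    (intervalIntegrable_eval_mul_jacobiWeight ha hb _)
  rw [intervalIntegral.integral_of_le (by norm_num), integral_Ioc_eq_integral_Ioo] at h
  rw [jacobiIntegral, h]
  simp [jacobiWeight, Real.zero_rpow (by linarith : a + 1 ≠ 0),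
    Real.zero_rpow (by linarith : b + 1 ≠ 0)]

lemma eq_zero_of_jacobiIntegral_mul_self {a b : ℝ} (ha : -1 < a) (hb : -1 < b) {p : ℝ[X]}
    (hp : jacobiIntegral a b (p * p) = 0) : p = 0 := by
  have hnonneg : 0 ≤ᵐ[volume.restrict (Set.Ioo (-1 : ℝ) 1)]
      fun x => (p * p).eval x * jacobiWeight a b x := by
    filter_upwards [ae_restrict_mem measurableSet_Ioo] with x hx
    rw [eval_mul]
    exact mul_nonneg (mul_self_nonneg _) (jacobiWeight_pos a b hx).le
  have h := (integral_eq_zero_iff_of_nonneg_ae hnonneg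
    (integrableOn_eval_mul_jacobiWeight ha hb (p * p))).1 hp
  by_contra hne
  have hroots : ∀ᵐ x ∂volume.restrict (Set.Ioo (-1 : ℝ) 1), x ∉ (p.roots.toFinset : Set ℝ) :=
    ae_restrict_of_ae
      (measure_eq_zero_iff_ae_notMem.1 (p.roots.toFinset.finite_toSet.measure_zero volume))
  have hfalse : ∀ᵐ x ∂volume.restrict (Set.Ioo (-1 : ℝ) 1), False := by
    filter_upwards [h, hroots, ae_restrict_mem measurableSet_Ioo] with x hx hxr hmem
    have hw := (jacobiWeight_pos a b hmem).ne'
    simp [hw, hne] at hx hxr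
    exact hxr hx
  rw [Filter.eventually_false_iff_eq_bot, ae_eq_bot, Measure.restrict_eq_zero] at hfalse
  norm_num at hfalse

/-- `p` is the monic polynomial of degree `n` orthogonal to all polynomials of lower degree with
respect to the Jacobi weight. -/
structure IsMonicJacobi (a b : ℝ) (n : ℕ) (p : ℝ[X]) : Prop where
  monic : p.Monic
  natDegree_eq : p.natDegree = n
  orth : ∀ q : ℝ[X], q.degree < n → jacobiIntegral a b (p * q) = 0

lemma IsMonicJacobi.of_monomials {a b : ℝ} (ha : -1 < a) (hb : -1 < b) {n : ℕ} {p : ℝ[X]}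
    (hm : p.Monic) (hd : p.natDegree = n)
    (ho : ∀ k < n, ∫ x in Set.Ioo (-1 : ℝ) 1,
      p.eval x * x ^ k * (1 - x) ^ a * (1 + x) ^ b = 0) : IsMonicJacobi a b n p := by
  refine ⟨hm, hd, fun q hq => ?_⟩
  rcases eq_or_ne q 0 with rfl | hq0
  · simp [jacobiIntegral]
  rw [q.as_sum_range_C_mul_X_pow' ((natDegree_lt_iff_degree_lt hq0).2 hq), Finset.mul_sum,
    jacobiIntegral_sum ha hb]
  refine Finset.sum_eq_zero fun k hk => ?_
  rw [mul_left_comm, jacobiIntegral_C_mul]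
  refine mul_eq_zero_of_right _ ?_
  rw [← ho k (Finset.mem_range.1 hk)]
  simp [jacobiIntegral, jacobiWeight, mul_assoc]

lemma IsMonicJacobi.unique {a b : ℝ} (ha : -1 < a) (hb : -1 < b) {n : ℕ} {p q : ℝ[X]}
    (hp : IsMonicJacobi a b n p) (hq : IsMonicJacobi a b n q) : p = q := by
  have hdeg : (p - q).degree < n := by
    rw [← hp.natDegree_eq, ← degree_eq_natDegree hp.monic.ne_zero]
    refine degree_sub_lt_left ?_ hp.monic.ne_zero ?_
    · rw [degree_eq_natDegree hp.monic.ne_zero, degree_eq_natDegree hq.monic.ne_zero,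
        hp.natDegree_eq, hq.natDegree_eq]
    · rw [hp.monic, hq.monic]
  refine sub_eq_zero.1 (eq_zero_of_jacobiIntegral_mul_self ha hb ?_)
  rw [show (p - q) * (p - q) = p * (p - q) + C (-1) * (q * (p - q)) by
    rw [C_neg, C_1]; ring, jacobiIntegral_add ha hb, jacobiIntegral_C_mul, hp.orth _ hdeg,
    hq.orth _ hdeg]
  simp

/-- The monic Jacobi polynomials, built with the raising operator
`p ↦ (1 - x²) p' + ((b + 1) (1 - x) - (a + 1) (1 + x)) p`. -/
noncomputable def monicJacobi : ℕ → ℝ → ℝ → ℝ[X]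
  | 0, _, _ => 1
  | n + 1, a, b => C (-((n : ℝ) + a + b + 2)⁻¹) *
      ((1 - X) * (1 + X) * derivative (monicJacobi n (a + 1) (b + 1))
        + pearsonPoly a b * monicJacobi n (a + 1) (b + 1))

lemma coeff_raise {n : ℕ} (a b : ℝ) {p : ℝ[X]} (hm : p.Monic) (hd : p.natDegree = n) :
    ((1 - X) * (1 + X) * derivative p + pearsonPoly a b * p).coeff (n + 1)
      = -((n : ℝ) + a + b + 2) := by
  have hn : p.coeff n = 1 := by rw [← hd]; exact hm
  have h1 : p.coeff (n + 1) = 0 := coeff_eq_zero_of_natDegree_lt (by omega)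
  have h2 : p.coeff (n + 1 + 1) = 0 := coeff_eq_zero_of_natDegree_lt (by omega)
  have e : (1 - X) * (1 + X) * derivative p + pearsonPoly a b * p
      = derivative p - X * (X * derivative p) + (C (b - a) * p - C (a + b + 2) * (X * p)) := by
    simp only [pearsonPoly, C_add, C_sub, C_1, C_ofNat]
    ring
  rw [e]
  simp only [coeff_add, coeff_sub, coeff_C_mul, coeff_X_mul, coeff_derivative, h1, h2, hn]
  rcases n with _ | m
  · simp
  · simp only [coeff_X_mul, coeff_derivative, hn]
    push_cast
    ring

lemma natDegree_raise_le {n : ℕ} (a b : ℝ) {p : ℝ[X]} (hd : p.natDegree = n) :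
    ((1 - X) * (1 + X) * derivative p + pearsonPoly a b * p).natDegree ≤ n + 1 := by
  have hX : ∀ c d : ℝ, (C c * (1 - X) - C d * (1 + X) : ℝ[X]).natDegree ≤ 1 := by
    intro c d
    compute_degree
  refine natDegree_add_le_of_degree_le ?_ ?_
  · rcases n with _ | m
    · rw [derivative_of_natDegree_zero hd]
      simp
    · have h2 : ((1 - X) * (1 + X) : ℝ[X]).natDegree ≤ 2 := by compute_degree
      have h3 := natDegree_derivative_le p
      have h4 := natDegree_mul_le (p := ((1 - X) * (1 + X) : ℝ[X])) (q := derivative p)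
      omega
  · refine natDegree_mul_le.trans ?_
    have := hX (b + 1) (a + 1)
    rw [pearsonPoly]
    omega

lemma isMonicJacobi_monicJacobi (n : ℕ) {a b : ℝ} (ha : -1 < a) (hb : -1 < b) :
    IsMonicJacobi a b n (monicJacobi n a b) := by
  induction n generalizing a b with
  | zero =>
    refine ⟨monic_one, natDegree_one, fun q hq => ?_⟩
    have : q = 0 := by simpa using hq
    simp [this, jacobiIntegral]
  | succ n ih =>
    have h := ih (a := a + 1) (b := b + 1) (by linarith) (by linarith)
    have hK : (n : ℝ) + a + b + 2 ≠ 0 := by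
      have : (0 : ℝ) ≤ n := n.cast_nonneg
      linarith
    rw [monicJacobi]
    have hcoeff := coeff_raise a b h.monic h.natDegree_eq
    have hle := natDegree_raise_le a b h.natDegree_eq
    generalize hp : monicJacobi n (a + 1) (b + 1) = p at *
    have hc : (C (-((n : ℝ) + a + b + 2)⁻¹) *
        ((1 - X) * (1 + X) * derivative p + pearsonPoly a b * p)).coeff (n + 1) = 1 := by
      rw [coeff_C_mul, hcoeff]
      field_simp
    have hle' := (natDegree_C_mul_le (-((n : ℝ) + a + b + 2)⁻¹) _).trans hle
    refine ⟨monic_of_natDegree_le_of_coeff_eq_one _ hle' hc,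
      natDegree_eq_of_le_of_coeff_ne_zero hle' (by rw [hc]; exact one_ne_zero), fun q hq => ?_⟩
    have hq' : (derivative q).degree < n := by
      rcases eq_or_ne q 0 with rfl | hq0
      · simp
      · refine lt_of_lt_of_le (degree_derivative_lt hq0) ?_
        rw [degree_eq_natDegree hq0] at hq ⊢
        norm_cast at hq ⊢
        omega
    have hparts := jacobiIntegral_pearson ha hb (p * q)
    have hlow := h.orth _ hq'
    rw [← jacobiIntegral_one_add_X_mul, ← jacobiIntegral_one_sub_X_mul] at hlow
    rw [show (1 - X) * (1 + X) * derivative (p * q) + pearsonPoly a b * (p * q)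
      = ((1 - X) * (1 + X) * derivative p + pearsonPoly a b * p) * q
        + (1 - X) * ((1 + X) * (p * derivative q)) by rw [derivative_mul]; ring,
      jacobiIntegral_add ha hb, hlow, add_zero] at hparts
    rw [mul_assoc, jacobiIntegral_C_mul, hparts, mul_zero]

lemma eval_neg_one_monicJacobi_succ (n : ℕ) (a b : ℝ) :
    (monicJacobi (n + 1) a b).eval (-1)
      = -(2 * (b + 1)) / ((n : ℝ) + a + b + 2)
        * (monicJacobi n (a + 1) (b + 1)).eval (-1) := by
  simp only [monicJacobi, pearsonPoly, eval_mul, eval_add, eval_sub, eval_one, eval_X, eval_C]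
  ring

lemma eval_neg_one_monicJacobi_ratio (n : ℕ) {a b : ℝ} (ha : -1 < a) (hb : -1 < b) :
    (2 * n + a + b + 1) * (2 * n + a + b + 2) * (monicJacobi (n + 1) a b).eval (-1)
      + 2 * (n + b + 1) * (n + a + b + 1) * (monicJacobi n a b).eval (-1) = 0 := by
  induction n generalizing a b with
  | zero =>
    have : a + b + 2 ≠ 0 := by linarith
    rw [eval_neg_one_monicJacobi_succ]
    simp only [monicJacobi, eval_one, Nat.cast_zero, mul_zero, zero_add]
    field_simp
    ring
  | succ n ih =>
    have h := ih (a := a + 1) (b := b + 1) (by linarith) (by linarith)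
    have hn : (0 : ℝ) ≤ n := n.cast_nonneg
    have h1 : (n : ℝ) + a + b + 2 ≠ 0 := by linarith
    have h2 : (n : ℝ) + 1 + a + b + 2 ≠ 0 := by linarith
    rw [eval_neg_one_monicJacobi_succ (n + 1), eval_neg_one_monicJacobi_succ n a b]
    push_cast
    field_simp
    linear_combination (-(2 * (b + 1)) * ((n : ℝ) + a + b + 2)) * h

lemma one_add_X_mul_monicJacobi {n : ℕ} (hn : 1 ≤ n) {a b : ℝ} (ha : -1 < a) (hb : -1 < b) :
    (1 + X) * monicJacobi n a (b + 1) = monicJacobi (n + 1) a b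
      + C (2 * (n + b + 1) * (n + a + b + 1) / ((2 * n + a + b + 1) * (2 * n + a + b + 2)))
        * monicJacobi n a b := by
  have hn' : (1 : ℝ) ≤ n := by exact_mod_cast hn
  have h1 : 2 * (n : ℝ) + a + b + 1 ≠ 0 := by linarith
  have h2 : 2 * (n : ℝ) + a + b + 2 ≠ 0 := by linarith
  have hr := eval_neg_one_monicJacobi_ratio n ha hb
  set c : ℝ := 2 * (n + b + 1) * (n + a + b + 1) / ((2 * n + a + b + 1) * (2 * n + a + b + 2))
    with hc
  have J := isMonicJacobi_monicJacobi n ha hb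
  have J' := isMonicJacobi_monicJacobi (n + 1) ha hb
  have hroot : (monicJacobi (n + 1) a b + C c * monicJacobi n a b).IsRoot (-1) := by
    rw [IsRoot, eval_add, eval_mul, eval_C, hc]
    field_simp
    linear_combination hr
  obtain ⟨E, hE⟩ := dvd_iff_isRoot.2 hroot
  have hfac : (X - C (-1) : ℝ[X]) = 1 + X := by rw [C_neg, C_1]; ring
  have hlt : (C c * monicJacobi n a b).degree < (monicJacobi (n + 1) a b).degree := by
    refine degree_lt_degree ((natDegree_C_mul_le c _).trans_lt ?_)
    rw [J.natDegree_eq, J'.natDegree_eq]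
    exact n.lt_succ_self
  have hsum : (monicJacobi (n + 1) a b + C c * monicJacobi n a b).Monic :=
    J'.monic.add_of_left hlt
  have hEm : E.Monic := (monic_X_sub_C (-1 : ℝ)).of_mul_monic_left (hE ▸ hsum)
  have hdeg : E.natDegree = n := by
    have h3 := congrArg natDegree hE
    rw [natDegree_add_eq_left_of_degree_lt hlt, J'.natDegree_eq,
      (monic_X_sub_C (-1 : ℝ)).natDegree_mul hEm, natDegree_X_sub_C] at h3
    omega
  rw [hE, hfac]
  congr 1
  refine (isMonicJacobi_monicJacobi n ha (by linarith)).unique ha (by linarith)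
    ⟨hEm, hdeg, fun q hq => ?_⟩
  rw [← jacobiIntegral_one_add_X_mul, ← mul_assoc, ← hfac, ← hE, add_mul,
    jacobiIntegral_add ha hb, mul_assoc, jacobiIntegral_C_mul, J.orth q hq,
    J'.orth q (hq.trans (by exact_mod_cast n.lt_succ_self))]
  simp

theorem jacobi_connection_formula_shifted_weight
    (α β : ℝ) (hα : -1 < α) (hβ : 1 < β)
    (P P₂ : ℕ → ℝ[X])
    (hPmonic : ∀ n, (P n).Monic) (hPdeg : ∀ n, (P n).natDegree = n)
    (hPorth : ∀ n k, k < n →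
      ∫ x in Set.Ioo (-1 : ℝ) 1, (P n).eval x * x ^ k * (1 - x) ^ α * (1 + x) ^ β = 0)
    (hP₂monic : ∀ n, (P₂ n).Monic) (hP₂deg : ∀ n, (P₂ n).natDegree = n)
    (hP₂orth : ∀ n k, k < n →
      ∫ x in Set.Ioo (-1 : ℝ) 1, (P₂ n).eval x * x ^ k * (1 - x) ^ α * (1 + x) ^ (β - 2) = 0) :
    ∀ n : ℕ, 1 ≤ n →
      (1 + X) ^ 2 * P n
        = P₂ (n + 2)
          + Polynomial.C (4 * (n + β) * (n + α + β)
              / ((2 * n + α + β) * (2 * n + α + β + 2))) * P₂ (n + 1)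
          + Polynomial.C (4 * (n + β - 1) * (n + β) * (n + α + β - 1) * (n + α + β)
              / ((2 * n + α + β - 1) * (2 * n + α + β) ^ 2 * (2 * n + α + β + 1)))
            * P₂ n := by
  intro n hn
  have hβ₀ : -1 < β := by linarith
  have hβ₂ : -1 < β - 2 := by linarith
  have hP : P n = monicJacobi n α β :=
    (IsMonicJacobi.of_monomials hα hβ₀ (hPmonic n) (hPdeg n) (hPorth n)).unique hα hβ₀
      (isMonicJacobi_monicJacobi n hα hβ₀)
  have hP₂ : ∀ m, P₂ m = monicJacobi m α (β - 2) := fun m =>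
    (IsMonicJacobi.of_monomials hα hβ₂ (hP₂monic m) (hP₂deg m) (hP₂orth m)).unique hα hβ₂
      (isMonicJacobi_monicJacobi m hα hβ₂)
  have hn' : (1 : ℝ) ≤ n := by exact_mod_cast hn
  have s0 : 2 * (n : ℝ) + α + β - 1 ≠ 0 := by linarith
  have s1 : 2 * (n : ℝ) + α + β ≠ 0 := by linarith
  have s2 : 2 * (n : ℝ) + α + β + 1 ≠ 0 := by linarith
  have s3 : 2 * (n : ℝ) + α + β + 2 ≠ 0 := by linarith
  have e1 := one_add_X_mul_monicJacobi hn hα (b := β - 1) (by linarith)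
  have e2 := one_add_X_mul_monicJacobi hn hα hβ₂
  have e3 := one_add_X_mul_monicJacobi (n := n + 1) (by omega) hα hβ₂
  rw [show β - 1 + 1 = β by ring] at e1
  rw [show β - 2 + 1 = β - 1 by ring] at e2 e3
  set c₁ : ℝ := 2 * (n + (β - 1) + 1) * (n + α + (β - 1) + 1)
    / ((2 * n + α + (β - 1) + 1) * (2 * n + α + (β - 1) + 2)) with hc₁
  set c₂ : ℝ := 2 * (n + (β - 2) + 1) * (n + α + (β - 2) + 1)
    / ((2 * n + α + (β - 2) + 1) * (2 * n + α + (β - 2) + 2)) with hc₂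
  set c₃ : ℝ := 2 * ((n + 1 : ℕ) + (β - 2) + 1) * ((n + 1 : ℕ) + α + (β - 2) + 1)
    / ((2 * (n + 1 : ℕ) + α + (β - 2) + 1) * (2 * (n + 1 : ℕ) + α + (β - 2) + 2)) with hc₃
  have k₁ : c₁ = 2 * (n + β) * (n + α + β) / ((2 * n + α + β) * (2 * n + α + β + 1)) := by
    rw [hc₁]; congr 1 <;> ring
  have k₂ : c₂ = 2 * (n + β - 1) * (n + α + β - 1)
      / ((2 * n + α + β - 1) * (2 * n + α + β)) := by
    rw [hc₂]; congr 1 <;> ring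
  have k₃ : c₃ = 2 * (n + β) * (n + α + β) / ((2 * n + α + β + 1) * (2 * n + α + β + 2)) := by
    rw [hc₃]; push_cast; congr 1 <;> ring
  have hA : 4 * (n + β) * (n + α + β) / ((2 * n + α + β) * (2 * n + α + β + 2)) = c₃ + c₁ := by
    rw [k₁, k₃, div_add_div _ _ (by simp [s2, s3]) (by simp [s1, s2]),
      div_eq_div_iff (by simp [s1, s3]) (by simp [s1, s2, s3])]
    ring
  have hB : 4 * (n + β - 1) * (n + β) * (n + α + β - 1) * (n + α + β)
      / ((2 * n + α + β - 1) * (2 * n + α + β) ^ 2 * (2 * n + α + β + 1)) = c₁ * c₂ := by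
    rw [k₁, k₂, div_mul_div_comm, div_eq_div_iff (by simp [s0, s1, s2]) (by simp [s0, s1, s2])]
    ring
  rw [hA, hB, hP, hP₂, hP₂, hP₂, C_add, C_mul]
  linear_combination (1 + X) * e1 + e3 + C c₁ * e2
end

section
/- For all fixed natural numbers k and s, the derivatives of the Christoffel–Darboux kernel at (−1,−1) satisfy lim_{n→∞} K_{n−1}^{(k,s)}(−1,−1) / n^{2β+2k+2s+2} = (−1)^{k+s} / (2^{α+β+k+s+1} (β+k+s+1) Γ(β+k+1) Γ(β+s+1)). -/
open MeasureTheory Polynomial Filter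

theorem ascPochhammer_eval_succ_left (n : ℕ) (x : ℝ) :
    (ascPochhammer ℝ (n + 1)).eval x = x * (ascPochhammer ℝ n).eval (x + 1) := by
  simp [ascPochhammer_succ_left]

theorem sum_choose_mul_ascPochhammer_div (n : ℕ) (b c : ℝ) (hc : 0 < c) :
    ∑ j ∈ Finset.range (n + 1),
      (-1) ^ j * (n.choose j : ℝ) *
        ((ascPochhammer ℝ j).eval b / (ascPochhammer ℝ j).eval c)
      = (ascPochhammer ℝ n).eval (c - b) / (ascPochhammer ℝ n).eval c := by
  induction n generalizing b c with
  | zero => simp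
  | succ n ih =>
    have hstep : ∑ j ∈ Finset.range (n + 1 + 1),
        (-1) ^ j * ((n + 1).choose j : ℝ) *
          ((ascPochhammer ℝ j).eval b / (ascPochhammer ℝ j).eval c)
        = ∑ j ∈ Finset.range (n + 1), (-1) ^ j * (n.choose j : ℝ) *
            ((ascPochhammer ℝ j).eval b / (ascPochhammer ℝ j).eval c)
          - b / c * ∑ j ∈ Finset.range (n + 1), (-1) ^ j * (n.choose j : ℝ) *
            ((ascPochhammer ℝ j).eval (b + 1) / (ascPochhammer ℝ j).eval (c + 1)) := by
      have hlast : ∑ j ∈ Finset.range (n + 1), (-1) ^ j * (n.choose j : ℝ) *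
            ((ascPochhammer ℝ j).eval b / (ascPochhammer ℝ j).eval c)
          = ∑ j ∈ Finset.range (n + 1 + 1), (-1) ^ j * (n.choose j : ℝ) *
            ((ascPochhammer ℝ j).eval b / (ascPochhammer ℝ j).eval c) := by
        rw [Finset.sum_range_succ _ (n + 1)]
        simp
      rw [hlast, Finset.sum_range_succ', Finset.sum_range_succ' _ (n + 1), Finset.mul_sum,
        add_sub_right_comm, ← Finset.sum_sub_distrib]
      congr 1
      · refine Finset.sum_congr rfl fun j _ => ?_
        rw [ascPochhammer_eval_succ_left, ascPochhammer_eval_succ_left, Nat.choose_succ_succ']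
        push_cast
        rw [mul_div_mul_comm]
        ring
      · simp
    have h1 : 0 < (ascPochhammer ℝ n).eval (c + 1) := ascPochhammer_pos n _ (by linarith)
    have h2 : 0 < (ascPochhammer ℝ n).eval c := ascPochhammer_pos n _ hc
    have h3 := ascPochhammer_eval_succ_left n c
    have h4 := ascPochhammer_succ_eval n c
    have h5 : c + n ≠ 0 := by positivity
    rw [hstep, ih b c hc, ih (b + 1) (c + 1) (by linarith), ascPochhammer_succ_eval,
      ascPochhammer_succ_eval, show c + 1 - (b + 1) = c - b by ring,
      show (ascPochhammer ℝ n).eval (c + 1) = (ascPochhammer ℝ n).eval c * (c + n) / c by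
        field_simp; linarith]
    field_simp
    ring

theorem Real.Gamma_add_natCast_eq_ascPochhammer_mul {x : ℝ} (hx : 0 < x) (n : ℕ) :
    Real.Gamma (x + n) = (ascPochhammer ℝ n).eval x * Real.Gamma x := by
  induction n with
  | zero => simp
  | succ n ih =>
    rw [Nat.cast_succ, ← add_assoc, Real.Gamma_add_one (by positivity), ih,
      ascPochhammer_succ_eval]
    ring

theorem intervalIntegrable_and_integral_rpow_mul_one_sub_rpow {a b : ℝ} (ha : 0 < a) (hb : 0 < b) :
    IntervalIntegrable (fun t : ℝ => t ^ (a - 1) * (1 - t) ^ (b - 1)) volume 0 1 ∧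
      ∫ t in (0 : ℝ)..1, t ^ (a - 1) * (1 - t) ^ (b - 1)
        = Real.Gamma a * Real.Gamma b / Real.Gamma (a + b) := by
  have heq : ∀ t ∈ Set.uIoc (0 : ℝ) 1,
      (t : ℂ) ^ ((a : ℂ) - 1) * (1 - (t : ℂ)) ^ ((b : ℂ) - 1)
        = ((t ^ (a - 1) * (1 - t) ^ (b - 1) : ℝ) : ℂ) := by
    intro t ht
    rw [Set.uIoc_of_le zero_le_one] at ht
    push_cast
    rw [Complex.ofReal_cpow ht.1.le, Complex.ofReal_cpow (by linarith [ht.2])]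
    push_cast
    rfl
  have hconv := Complex.betaIntegral_convergent (u := a) (v := b) (by simpa) (by simpa)
  constructor
  · have h := (intervalIntegrable_congr heq).1 hconv
    rw [intervalIntegrable_iff] at h ⊢
    simpa [IntegrableOn] using h.re
  · have h := Complex.betaIntegral_eq_Gamma_mul_div a b (by simpa) (by simpa)
    rw [Complex.betaIntegral, intervalIntegral.integral_congr_ae (ae_of_all _ heq),
      intervalIntegral.integral_ofReal] at h
    rw [← Complex.ofReal_add, Complex.Gamma_ofReal, Complex.Gamma_ofReal, Complex.Gamma_ofReal] at h
    exact_mod_cast h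

theorem integrableOn_and_integral_jacobi_weight {a b : ℝ} (ha : -1 < a) (hb : -1 < b) :
    IntegrableOn (fun x : ℝ => (1 - x) ^ a * (1 + x) ^ b) (Set.Ioo (-1) 1) ∧
      ∫ x in Set.Ioo (-1 : ℝ) 1, (1 - x) ^ a * (1 + x) ^ b
        = 2 ^ (a + b + 1) * (Real.Gamma (a + 1) * Real.Gamma (b + 1) / Real.Gamma (a + b + 2)) := by
  obtain ⟨hintegrable, hval⟩ := intervalIntegrable_and_integral_rpow_mul_one_sub_rpow
    (a := b + 1) (b := a + 1) (by linarith) (by linarith)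
  simp only [add_sub_cancel_right] at hintegrable hval
  have heq : Set.EqOn (fun x : ℝ => (1 - x) ^ a * (1 + x) ^ b)
      (fun x => 2 ^ (a + b) * ((x / 2 + 1 / 2) ^ b * (1 - (x / 2 + 1 / 2)) ^ a))
      (Set.Ioo (-1) 1) := by
    intro x hx
    have h1 : 0 ≤ x / 2 + 1 / 2 := by linarith [hx.1]
    have h2 : 0 ≤ 1 - (x / 2 + 1 / 2) := by linarith [hx.2]
    simp only
    rw [show 1 - x = 2 * (1 - (x / 2 + 1 / 2)) by ring,
      show 1 + x = 2 * (x / 2 + 1 / 2) by ring, Real.mul_rpow zero_le_two h1,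
      Real.mul_rpow zero_le_two h2, Real.rpow_add two_pos]
    ring
  have hintegrable' : IntervalIntegrable
      (fun x : ℝ => (x / 2 + 1 / 2) ^ b * (1 - (x / 2 + 1 / 2)) ^ a) volume (-1) 1 := by
    have h := (hintegrable.comp_add_right (1 / 2)).comp_mul_left (c := (1 / 2 : ℝ))
    norm_num at h
    convert h using 4 <;> ring
  have hval' : ∫ x in (-1 : ℝ)..1, (x / 2 + 1 / 2) ^ b * (1 - (x / 2 + 1 / 2)) ^ a
      = 2 * (Real.Gamma (b + 1) * Real.Gamma (a + 1) / Real.Gamma (b + 1 + (a + 1))) := by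
    have h := intervalIntegral.integral_comp_div_add (a := -1) (b := 1) (c := 2)
      (fun t : ℝ => t ^ b * (1 - t) ^ a) two_ne_zero (1 / 2)
    rw [h, ← hval]
    norm_num
  constructor
  · rw [integrableOn_congr_fun heq measurableSet_Ioo]
    rw [intervalIntegrable_iff_integrableOn_Ioo_of_le (by norm_num)] at hintegrable'
    exact hintegrable'.const_mul _
  · rw [setIntegral_congr_fun measurableSet_Ioo heq, ← integral_Ioc_eq_integral_Ioo,
      ← intervalIntegral.integral_of_le (by norm_num), intervalIntegral.integral_const_mul,
      hval', Real.rpow_add_one two_ne_zero, show b + 1 + (a + 1) = a + b + 2 by ring]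
    ring

theorem integrableOn_eval_mul_jacobi_weight {α β : ℝ} (hα : -1 < α) (hβ : -1 < β) (p : ℝ[X]) :
    IntegrableOn (fun x : ℝ => p.eval x * ((1 - x) ^ α * (1 + x) ^ β)) (Set.Ioo (-1) 1) := by
  have h := (integrableOn_and_integral_jacobi_weight hα hβ).1
  rw [← integrableOn_Icc_iff_integrableOn_Ioo] at h ⊢
  exact h.continuousOn_mul p.continuous.continuousOn isCompact_Icc

/-- Integration of a polynomial against the Jacobi weight `(1 - x) ^ α * (1 + x) ^ β`. -/
noncomputable def jacobiFunctional {α β : ℝ} (hα : -1 < α) (hβ : -1 < β) : ℝ[X] →ₗ[ℝ] ℝ where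
  toFun p := ∫ x in Set.Ioo (-1 : ℝ) 1, p.eval x * ((1 - x) ^ α * (1 + x) ^ β)
  map_add' p q := by
    simp only [eval_add, add_mul]
    exact integral_add (integrableOn_eval_mul_jacobi_weight hα hβ p)
      (integrableOn_eval_mul_jacobi_weight hα hβ q)
  map_smul' c p := by
    simp only [eval_smul, smul_eq_mul, mul_assoc, RingHom.id_apply]
    exact integral_const_mul _ _

section

variable {α β : ℝ} (hα : -1 < α) (hβ : -1 < β)

theorem jacobiFunctional_apply (p : ℝ[X]) : jacobiFunctional hα hβ p
    = ∫ x in Set.Ioo (-1 : ℝ) 1, p.eval x * ((1 - x) ^ α * (1 + x) ^ β) := rfl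

theorem jacobiFunctional_C_mul (c : ℝ) (p : ℝ[X]) :
    jacobiFunctional hα hβ (C c * p) = c * jacobiFunctional hα hβ p := by
  rw [← smul_eq_C_mul, map_smul, smul_eq_mul]

theorem jacobiFunctional_add_pow_mul_sub_pow (i j : ℕ) :
    jacobiFunctional hα hβ ((X + C 1) ^ j * (1 - X) ^ i)
      = 2 ^ (α + i + (β + j) + 1) * (Real.Gamma (α + i + 1) * Real.Gamma (β + j + 1)
          / Real.Gamma (α + i + (β + j) + 2)) := by
  have hi : (0 : ℝ) ≤ i := i.cast_nonneg
  have hj : (0 : ℝ) ≤ j := j.cast_nonneg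
  rw [← (integrableOn_and_integral_jacobi_weight (a := α + i) (b := β + j)
    (by linarith) (by linarith)).2, jacobiFunctional_apply]
  refine setIntegral_congr_fun measurableSet_Ioo fun x hx => ?_
  have h1 : 0 < 1 - x := by linarith [hx.2]
  have h2 : 0 < 1 + x := by linarith [hx.1]
  simp only [eval_mul, eval_pow, eval_add, eval_sub, eval_X, eval_C, eval_one]
  rw [Real.rpow_add_natCast h1.ne', Real.rpow_add_natCast h2.ne', add_comm x 1]
  ring

theorem eq_zero_of_jacobiFunctional_mul_self_eq_zero {p : ℝ[X]}
    (h : jacobiFunctional hα hβ (p * p) = 0) : p = 0 := by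
  by_contra hp
  have hw : ∀ x ∈ Set.Ioo (-1 : ℝ) 1, 0 < (1 - x) ^ α * (1 + x) ^ β := fun x hx =>
    mul_pos (Real.rpow_pos_of_pos (by linarith [hx.2]) _)
      (Real.rpow_pos_of_pos (by linarith [hx.1]) _)
  have hpos := (setIntegral_pos_iff_support_of_nonneg_ae (μ := volume) (s := Set.Ioo (-1 : ℝ) 1)
    (f := fun x => (p * p).eval x * ((1 - x) ^ α * (1 + x) ^ β))
    ((ae_restrict_iff' measurableSet_Ioo).2 (ae_of_all _ fun x hx => by
      simpa using mul_nonneg (mul_self_nonneg _) (hw x hx).le))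
    (integrableOn_eval_mul_jacobi_weight hα hβ (p * p))).2 ?_
  · exact hpos.ne' h
  · have hsub : Set.Ioo (-1 : ℝ) 1 \ (p.roots.toFinset : Set ℝ) ⊆
        Function.support (fun x => (p * p).eval x * ((1 - x) ^ α * (1 + x) ^ β))
          ∩ Set.Ioo (-1 : ℝ) 1 := by
      rintro x ⟨hx, hroot⟩
      have hx0 : p.eval x ≠ 0 := by simpa [hp] using hroot
      refine ⟨?_, hx⟩
      simp only [Function.mem_support, eval_mul]
      exact mul_ne_zero (mul_ne_zero hx0 hx0) (hw x hx).ne'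
    refine lt_of_lt_of_le ?_ (measure_mono hsub)
    rw [measure_sdiff_null (p.roots.toFinset.finite_toSet.measure_zero _)]
    simp

end

theorem degree_sub_C_mul_lt {p q : ℝ[X]} {n : ℕ} (hp : p.natDegree ≤ n) (hq : q.natDegree ≤ n)
    {c : ℝ} (hc : p.coeff n = c * q.coeff n) : (p - C c * q).degree < n := by
  rw [degree_lt_iff_coeff_zero]
  intro m hm
  rw [coeff_sub, coeff_C_mul]
  rcases hm.eq_or_lt with rfl | h
  · rw [hc, sub_self]
  · rw [coeff_eq_zero_of_natDegree_lt (hp.trans_lt h),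
      coeff_eq_zero_of_natDegree_lt (hq.trans_lt h), mul_zero, sub_zero]

/-- The Jacobi polynomial normalized to take the value `1` at `-1`. -/
noncomputable def jacobiAtNegOne (α β : ℝ) (n : ℕ) : ℝ[X] :=
  ∑ j ∈ Finset.range (n + 1),
    C ((-1) ^ j * (n.choose j : ℝ) * (ascPochhammer ℝ j).eval (n + (α + β + 1))
      / ((ascPochhammer ℝ j).eval (β + 1) * 2 ^ j)) * (X + C 1) ^ j

theorem iterate_derivative_jacobiAtNegOne_eval (α β : ℝ) (n k : ℕ) :
    (derivative^[k] (jacobiAtNegOne α β n)).eval (-1)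
      = (-1) ^ k * (n.descFactorial k : ℝ) * (ascPochhammer ℝ k).eval (n + (α + β + 1))
        / ((ascPochhammer ℝ k).eval (β + 1) * 2 ^ k) := by
  rw [jacobiAtNegOne, iterate_derivative_sum, eval_finsetSum, Finset.sum_eq_single k]
  · rw [iterate_derivative_C_mul, iterate_derivative_X_add_pow, Nat.descFactorial_self,
      Nat.descFactorial_eq_factorial_mul_choose]
    simp
    ring
  · intro j _ hjk
    rw [iterate_derivative_C_mul, iterate_derivative_X_add_pow]
    rcases lt_or_gt_of_ne hjk with h | h
    · simp [Nat.descFactorial_eq_zero_iff_lt.2 h]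
    · simp [Nat.sub_ne_zero_of_lt h]
  · intro hk
    have : n < k := by simpa using hk
    rw [Nat.choose_eq_zero_of_lt this]
    simp

theorem jacobiAtNegOne_eval_neg_one (α β : ℝ) (n : ℕ) :
    (jacobiAtNegOne α β n).eval (-1) = 1 := by
  simpa using iterate_derivative_jacobiAtNegOne_eval α β n 0

theorem natDegree_jacobiAtNegOne_le (α β : ℝ) (n : ℕ) :
    (jacobiAtNegOne α β n).natDegree ≤ n := by
  refine natDegree_sum_le_of_forall_le _ _ fun j hj => ?_
  refine (natDegree_C_mul_le _ _).trans ?_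
  rw [natDegree_pow, natDegree_X_add_C, mul_one]
  exact Finset.mem_range_succ_iff.1 hj

theorem coeff_jacobiAtNegOne_self (α β : ℝ) (n : ℕ) :
    (jacobiAtNegOne α β n).coeff n
      = (-1) ^ n * (ascPochhammer ℝ n).eval (n + (α + β + 1))
        / ((ascPochhammer ℝ n).eval (β + 1) * 2 ^ n) := by
  rw [jacobiAtNegOne, finsetSum_coeff, Finset.sum_eq_single n]
  · rw [coeff_C_mul, coeff_X_add_C_pow]
    simp
  · intro j hj hjn
    have : j < n := lt_of_le_of_ne (Finset.mem_range_succ_iff.1 hj) hjn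
    rw [coeff_C_mul, coeff_X_add_C_pow, Nat.choose_eq_zero_of_lt this]
    simp
  · simp

section

variable {α β : ℝ} (hα : -1 < α) (hβ : -1 < β)

theorem jacobiFunctional_jacobiAtNegOne_mul_sub_pow (n i : ℕ) :
    jacobiFunctional hα hβ (jacobiAtNegOne α β n * (1 - X) ^ i)
      = 2 ^ (α + β + i + 1) * (Real.Gamma (α + i + 1) * Real.Gamma (β + 1)
          / Real.Gamma (α + β + i + 2 + n))
        * (ascPochhammer ℝ n).eval (i + 1 - n : ℝ) := by
  have hi : (0 : ℝ) ≤ i := i.cast_nonneg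
  have hc : 0 < α + β + i + 2 := by linarith
  have hb : 0 < β + 1 := by linarith
  rw [Real.Gamma_add_natCast_eq_ascPochhammer_mul hc n,
    show (i + 1 - n : ℝ) = α + β + i + 2 - (n + (α + β + 1)) by ring]
  have hG := Real.Gamma_pos_of_pos hc
  have key := sum_choose_mul_ascPochhammer_div n (n + (α + β + 1)) (α + β + i + 2) hc
  have hn := ascPochhammer_pos n _ hc
  rw [eq_div_iff hn.ne'] at key
  rw [← key, jacobiAtNegOne, Finset.sum_mul, map_sum, Finset.sum_mul, Finset.mul_sum]
  refine Finset.sum_congr rfl fun j _ => ?_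
  have hj := ascPochhammer_pos j _ hc
  have hj' := ascPochhammer_pos j _ hb
  rw [mul_assoc, jacobiFunctional_C_mul, jacobiFunctional_add_pow_mul_sub_pow,
    show β + j + 1 = β + 1 + j by ring, Real.Gamma_add_natCast_eq_ascPochhammer_mul hb,
    show α + i + (β + j) + 2 = α + β + i + 2 + j by ring,
    Real.Gamma_add_natCast_eq_ascPochhammer_mul hc,
    show α + i + (β + j) + 1 = α + β + i + 1 + j by ring, Real.rpow_add_natCast two_ne_zero]
  field_simp

theorem jacobiFunctional_jacobiAtNegOne_mul_eq_zero {n : ℕ} {p : ℝ[X]} (hp : p.degree < n) :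
    jacobiFunctional hα hβ (jacobiAtNegOne α β n * p) = 0 := by
  rcases eq_or_ne p 0 with rfl | h0
  · simp
  have hdeg : (p.comp (1 - X)).natDegree < n := by
    rw [natDegree_comp, show (1 - X : ℝ[X]).natDegree = 1 by compute_degree!, mul_one]
    exact (natDegree_lt_iff_degree_lt h0).2 hp
  have hcomp : p = ∑ i ∈ Finset.range n, C ((p.comp (1 - X)).coeff i) * (1 - X) ^ i := by
    have h := congrArg (fun q : ℝ[X] => q.comp (1 - X))
      ((p.comp (1 - X)).as_sum_range_C_mul_X_pow' hdeg)
    simpa [comp_assoc, sum_comp] using h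
  rw [hcomp, Finset.mul_sum, map_sum]
  refine Finset.sum_eq_zero fun i hi => ?_
  have hin : i < n := Finset.mem_range.1 hi
  rw [mul_left_comm, jacobiFunctional_C_mul, jacobiFunctional_jacobiAtNegOne_mul_sub_pow,
    (ascPochhammer_eval_eq_zero_iff n _).2 ⟨n - 1 - i, by omega, ?_⟩]
  · simp
  · rw [Nat.sub_sub, Nat.cast_sub (by omega)]
    push_cast
    ring

theorem jacobiFunctional_jacobiAtNegOne_mul_self (n : ℕ) :
    jacobiFunctional hα hβ (jacobiAtNegOne α β n * jacobiAtNegOne α β n)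
      = 2 ^ (α + β + 1) * (ascPochhammer ℝ n).eval (n + (α + β + 1)) * n.factorial
        * (Real.Gamma (α + n + 1) * Real.Gamma (β + 1))
        / ((ascPochhammer ℝ n).eval (β + 1) * Real.Gamma (α + β + n + 2 + n)) := by
  have hpow : ((1 - X : ℝ[X]) ^ n).coeff n = (-1) ^ n := by
    have h := coeff_pow_of_natDegree_le (R := ℝ) (p := 1 - X) (m := n) (n := 1)
      (by compute_degree)
    simpa [coeff_one] using h
  have hdeg : ((1 - X : ℝ[X]) ^ n).natDegree ≤ n := by
    rw [natDegree_pow, show (1 - X : ℝ[X]).natDegree = 1 by compute_degree!, mul_one]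
  set c : ℝ := (-1) ^ n * (jacobiAtNegOne α β n).coeff n with hcdef
  have hlt := degree_sub_C_mul_lt (natDegree_jacobiAtNegOne_le α β n) hdeg (c := c) (by
    rw [hpow, hcdef, mul_right_comm, ← mul_pow]; simp)
  have h := jacobiFunctional_jacobiAtNegOne_mul_eq_zero hα hβ hlt
  rw [mul_sub, map_sub, sub_eq_zero, mul_left_comm, jacobiFunctional_C_mul,
    jacobiFunctional_jacobiAtNegOne_mul_sub_pow, add_sub_cancel_left,
    ascPochhammer_eval_one, show α + β + n + 1 = α + β + 1 + n by ring,
    Real.rpow_add_natCast two_ne_zero] at h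
  rw [h, hcdef, coeff_jacobiAtNegOne_self, ← mul_div_assoc, ← mul_assoc ((-1 : ℝ) ^ n),
    ← mul_pow]
  simp
  field_simp

theorem jacobiAtNegOne_eq_C_mul {n : ℕ} {P : ℝ[X]} (hP : P.natDegree = n) (hP0 : P ≠ 0)
    (horth : ∀ k < n, jacobiFunctional hα hβ (P * X ^ k) = 0) :
    ∃ c : ℝ, c ≠ 0 ∧ jacobiAtNegOne α β n = C c * P := by
  set Q := jacobiAtNegOne α β n with hQ
  have hlead : P.coeff n ≠ 0 := by
    rw [← hP]
    exact leadingCoeff_ne_zero.2 hP0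
  have hlt : (Q - C (Q.coeff n / P.coeff n) * P).degree < n :=
    degree_sub_C_mul_lt (natDegree_jacobiAtNegOne_le α β n) hP.le
      (div_mul_cancel₀ _ hlead).symm
  have horth' : ∀ p : ℝ[X], p.degree < n → jacobiFunctional hα hβ (P * p) = 0 := by
    intro p hp
    rcases eq_or_ne p 0 with rfl | h0
    · simp
    rw [p.as_sum_range_C_mul_X_pow' ((natDegree_lt_iff_degree_lt h0).2 hp), Finset.mul_sum,
      map_sum]
    refine Finset.sum_eq_zero fun i hi => ?_
    rw [mul_left_comm, jacobiFunctional_C_mul, horth i (Finset.mem_range.1 hi), mul_zero]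
  have heq : Q = C (Q.coeff n / P.coeff n) * P := by
    refine sub_eq_zero.1 (eq_zero_of_jacobiFunctional_mul_self_eq_zero hα hβ ?_)
    nth_rewrite 1 [sub_mul]
    rw [map_sub, jacobiFunctional_jacobiAtNegOne_mul_eq_zero hα hβ hlt, mul_assoc,
      jacobiFunctional_C_mul, horth' _ hlt, mul_zero, sub_zero]
  refine ⟨_, fun h0 => ?_, heq⟩
  have h1 := jacobiAtNegOne_eval_neg_one α β n
  rw [← hQ, heq, h0] at h1
  simp at h1

end

theorem ratio_eq_of_eq_C_mul (L : ℝ[X] →ₗ[ℝ] ℝ) {P Q : ℝ[X]} {c : ℝ} (hc : c ≠ 0)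
    (h : Q = C c * P) (k s : ℕ) (x : ℝ) :
    (derivative^[k] P).eval x * (derivative^[s] P).eval x / L (P * P)
      = (derivative^[k] Q).eval x * (derivative^[s] Q).eval x / L (Q * Q) := by
  rw [h, iterate_derivative_C_mul, iterate_derivative_C_mul, eval_C_mul, eval_C_mul,
    show C c * P * (C c * P) = (c * c) • (P * P) by rw [smul_eq_C_mul, C_mul]; ring,
    map_smul, smul_eq_mul, mul_mul_mul_comm, mul_div_mul_left _ _ (mul_ne_zero hc hc)]

theorem tendsto_natCast_add_const_div_natCast (c : ℝ) :
    Tendsto (fun n : ℕ => ((n : ℝ) + c) / n) atTop (nhds 1) := by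
  have h := (tendsto_const_div_atTop_nhds_zero_nat c).const_add 1
  rw [add_zero] at h
  refine h.congr' ?_
  filter_upwards [eventually_ne_atTop 0] with n hn
  have : (n : ℝ) ≠ 0 := Nat.cast_ne_zero.2 hn
  field_simp

theorem tendsto_ascPochhammer_eval_div_pow (c : ℝ) (k : ℕ) :
    Tendsto (fun n : ℕ => (ascPochhammer ℝ k).eval (n + c) / (n : ℝ) ^ k) atTop (nhds 1) := by
  induction k with
  | zero => simp
  | succ k ih =>
    have h := ih.mul (tendsto_natCast_add_const_div_natCast (c + k))
    rw [mul_one] at h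
    refine h.congr fun n => ?_
    rw [ascPochhammer_succ_eval, pow_succ, div_mul_div_comm, add_assoc]

theorem tendsto_descFactorial_div_pow (k : ℕ) :
    Tendsto (fun n : ℕ => (n.descFactorial k : ℝ) / (n : ℝ) ^ k) atTop (nhds 1) := by
  have h := isEquivalent_descFactorial k
  refine (Asymptotics.isEquivalent_iff_tendsto_one ?_).1 h
  filter_upwards [eventually_ne_atTop 0] with n hn
  exact pow_ne_zero _ (Nat.cast_ne_zero.2 hn)

/-- `Γ(n + a + 1) / (n! n ^ a) → 1` for every real `a`. -/
theorem tendsto_Gamma_add_div_factorial_mul_rpow (a : ℝ) :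
    Tendsto (fun n : ℕ => Real.Gamma (n + a + 1) / (n.factorial * (n : ℝ) ^ a)) atTop
      (nhds 1) := by
  have hpos : ∀ a : ℝ, 0 < a →
      Tendsto (fun n : ℕ => Real.Gamma (n + a + 1) / (n.factorial * (n : ℝ) ^ a)) atTop
        (nhds 1) := by
    intro a ha
    have hG := (Real.Gamma_pos_of_pos ha).ne'
    have h := (Real.GammaSeq_tendsto_Gamma a).inv₀ hG |>.const_mul (Real.Gamma a)
    rw [mul_inv_cancel₀ hG] at h
    refine h.congr fun n => ?_
    have hprod : Real.Gamma (n + a + 1)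
        = (∏ j ∈ Finset.range (n + 1), (a + j)) * Real.Gamma a := by
      induction n with
      | zero => simp [Real.Gamma_add_one ha.ne']
      | succ n ih =>
        rw [Finset.prod_range_succ, mul_right_comm, ← ih,
          show ((n + 1 : ℕ) : ℝ) + a + 1 = (n + a + 1) + 1 by push_cast; ring,
          Real.Gamma_add_one (by positivity)]
        push_cast
        ring
    rw [hprod, Real.GammaSeq, inv_div, mul_comm (n.factorial : ℝ)]
    ring
  have hstep : ∀ a : ℝ,
      Tendsto (fun n : ℕ => Real.Gamma (n + (a + 1) + 1) / (n.factorial * (n : ℝ) ^ (a + 1))) atTop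
        (nhds 1) →
      Tendsto (fun n : ℕ => Real.Gamma (n + a + 1) / (n.factorial * (n : ℝ) ^ a)) atTop
        (nhds 1) := by
    intro a h
    have h' := h.div (tendsto_natCast_add_const_div_natCast (a + 1)) one_ne_zero
    rw [div_one] at h'
    refine h'.congr' ?_
    filter_upwards [eventually_ne_atTop 0, eventually_gt_atTop ⌈-(a + 1)⌉₊] with n hn hna
    have hn0 : (0 : ℝ) < n := by positivity
    have h1 : 0 < (n : ℝ) + (a + 1) := by linarith [Nat.lt_of_ceil_lt hna]
    simp only [Pi.div_apply]
    rw [Real.Gamma_add_one h1.ne', Real.rpow_add_one hn0.ne', ← add_assoc]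
    rw [← add_assoc] at h1
    have h2 := (Real.rpow_pos_of_pos hn0 a).ne'
    field_simp
  obtain ⟨m, hm⟩ := exists_nat_gt (-a)
  have key : ∀ m : ℕ, ∀ a : ℝ, -a < m →
      Tendsto (fun n : ℕ => Real.Gamma (n + a + 1) / (n.factorial * (n : ℝ) ^ a)) atTop
        (nhds 1) := by
    intro m
    induction m with
    | zero => exact fun a h => hpos a (by simpa using h)
    | succ m ih =>
      exact fun a h => hstep a (ih (a + 1) (by push_cast at h; linarith))
  exact key m a hm

theorem tendsto_rpow_succ_sub_rpow_div_rpow (q : ℝ) :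
    Tendsto (fun n : ℕ => (((n + 1 : ℕ) : ℝ) ^ q - (n : ℝ) ^ q) / (n : ℝ) ^ (q - 1)) atTop
      (nhds q) := by
  have hd : HasDerivAt (fun x : ℝ => x ^ q) q 1 := by
    simpa using Real.hasDerivAt_rpow_const (x := 1) (p := q) (Or.inl one_ne_zero)
  have hlim : Tendsto (fun n : ℕ => (n : ℝ)⁻¹) atTop (nhdsWithin 0 {0}ᶜ) := by
    refine tendsto_nhdsWithin_iff.2 ⟨tendsto_inv_atTop_nhds_zero_nat, ?_⟩
    filter_upwards [eventually_ne_atTop 0] with n hn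
    simpa using hn
  refine ((hasDerivAt_iff_tendsto_slope_zero.1 hd).comp hlim).congr' ?_
  filter_upwards [eventually_ne_atTop 0] with n hn
  have hn0 : (0 : ℝ) < n := by positivity
  simp only [Function.comp_apply, smul_eq_mul, inv_inv, Real.one_rpow]
  rw [Nat.cast_succ, Real.rpow_sub_one hn0.ne', show (1 : ℝ) + (n : ℝ)⁻¹ = (n + 1) / n by field_simp,
    Real.div_rpow (by positivity) hn0.le]
  have h2 := (Real.rpow_pos_of_pos hn0 q).ne'
  field_simp

/-- Cesàro summation of sequences with power growth. -/
theorem tendsto_sum_range_div_rpow {f : ℕ → ℝ} {C q : ℝ} (hq : 0 < q)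
    (hf : Tendsto (fun n : ℕ => f n / (n : ℝ) ^ (q - 1)) atTop (nhds C)) :
    Tendsto (fun n : ℕ => (∑ m ∈ Finset.range n, f m) / (n : ℝ) ^ q) atTop (nhds (C / q)) := by
  set g : ℕ → ℝ := fun n => ((n + 1 : ℕ) : ℝ) ^ q - (n : ℝ) ^ q with hg
  have hgsum : ∀ n : ℕ, ∑ m ∈ Finset.range n, g m = (n : ℝ) ^ q := fun n => by
    rw [hg, Finset.sum_range_sub (fun m : ℕ => (m : ℝ) ^ q)]
    simp [Real.zero_rpow hq.ne']
  have hgpos : ∀ n, 0 < g n := fun n =>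
    sub_pos.2 (Real.rpow_lt_rpow n.cast_nonneg (by push_cast; linarith) hq)
  have hratio : Tendsto (fun n => f n / g n) atTop (nhds (C / q)) := by
    refine (hf.div (tendsto_rpow_succ_sub_rpow_div_rpow q) hq.ne').congr' ?_
    filter_upwards [eventually_ne_atTop 0] with n hn
    have hn0 : (0 : ℝ) < n := by positivity
    exact div_div_div_cancel_right₀ (Real.rpow_pos_of_pos hn0 _).ne' _ _
  have hlittle : (fun n => f n - C / q * g n) =o[atTop] g := by
    refine (Asymptotics.isLittleO_iff_tendsto fun n h => absurd h (hgpos n).ne').2 ?_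
    refine (tendsto_sub_nhds_zero_iff.2 hratio).congr fun n => ?_
    rw [sub_div, mul_div_cancel_right₀ _ (hgpos n).ne']
  have htop : Tendsto (fun n : ℕ => (n : ℝ) ^ q) atTop atTop :=
    (tendsto_rpow_atTop hq).comp tendsto_natCast_atTop_atTop
  have hsum := hlittle.sum_range (fun n => (hgpos n).le) (by simpa only [hgsum] using htop)
  have h := (hsum.tendsto_div_nhds_zero).add_const (C / q)
  rw [zero_add] at h
  refine h.congr' ?_
  filter_upwards [eventually_ne_atTop 0] with n hn
  have hn0 : (0 : ℝ) < n := by positivity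
  rw [hgsum, Finset.sum_sub_distrib, ← Finset.mul_sum, hgsum, sub_div,
    mul_div_cancel_right₀ _ (Real.rpow_pos_of_pos hn0 _).ne', sub_add_cancel]

section

variable {α β : ℝ} (hα : -1 < α) (hβ : -1 < β)

theorem tendsto_jacobiFunctional_jacobiAtNegOne_mul_self :
    Tendsto (fun n : ℕ => jacobiFunctional hα hβ (jacobiAtNegOne α β n * jacobiAtNegOne α β n)
      * (n : ℝ) ^ (2 * β + 1)) atTop (nhds (2 ^ (α + β) * Real.Gamma (β + 1) ^ 2)) := by
  have hb : 0 < β + 1 := by linarith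
  have hfrac : Tendsto (fun n : ℕ => (2 * (((n : ℝ) + (α + β + 1) / 2) / n))⁻¹) atTop
      (nhds (2 * 1)⁻¹) :=
    ((tendsto_natCast_add_const_div_natCast _).const_mul 2).inv₀ (by norm_num)
  have h := ((((tendsto_Gamma_add_div_factorial_mul_rpow α).div
    ((tendsto_Gamma_add_div_factorial_mul_rpow (α + β)).mul
      (tendsto_Gamma_add_div_factorial_mul_rpow β)) (by norm_num)).mul hfrac)).const_mul
    (2 ^ (α + β + 1) * Real.Gamma (β + 1) ^ 2)
  rw [show 2 ^ (α + β + 1) * Real.Gamma (β + 1) ^ 2 * (1 / (1 * 1) * (2 * 1)⁻¹)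
    = 2 ^ (α + β) * Real.Gamma (β + 1) ^ 2 by rw [Real.rpow_add_one two_ne_zero]; ring] at h
  refine h.congr' ?_
  filter_upwards [eventually_ne_atTop 0] with n hn
  have hn0 : (0 : ℝ) < n := by positivity
  have hn1 : (1 : ℝ) ≤ n := by exact_mod_cast Nat.one_le_iff_ne_zero.2 hn
  have hna : 0 < n + (α + β + 1) := by linarith
  have h2na : 0 < n + (α + β + 1) + n := by linarith
  have hasc1 := Real.Gamma_add_natCast_eq_ascPochhammer_mul hna n
  have hasc2 := Real.Gamma_add_natCast_eq_ascPochhammer_mul hb n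
  have hpos1 := ascPochhammer_pos n _ hna
  have hpos2 := ascPochhammer_pos n _ hb
  have hG1 := Real.Gamma_pos_of_pos hna
  have hG2 := Real.Gamma_pos_of_pos hb
  have hα' := Real.rpow_pos_of_pos hn0 α
  have hβ' := Real.rpow_pos_of_pos hn0 β
  have hf : (0 : ℝ) < n.factorial := by positivity
  simp only [Pi.div_apply]
  rw [jacobiFunctional_jacobiAtNegOne_mul_self,
    show α + β + n + 2 + n = n + (α + β + 1) + n + 1 by ring, Real.Gamma_add_one h2na.ne',
    hasc1, show (n : ℝ) + (α + β) + 1 = n + (α + β + 1) by ring,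
    show (n : ℝ) + β + 1 = β + 1 + n by ring, hasc2, show α + n + 1 = n + α + 1 by ring,
    Real.rpow_add_one hn0.ne', two_mul β, Real.rpow_add hn0, Real.rpow_add hn0,
    show n + (α + β + 1) + (n : ℝ) = 2 * (n + (α + β + 1) / 2) by ring]
  have h3 : 0 < n + (α + β + 1) / 2 := by linarith
  field_simp

theorem tendsto_jacobi_kernel_term (k s : ℕ) :
    Tendsto (fun n : ℕ => ((derivative^[k] (jacobiAtNegOne α β n)).eval (-1)
        * (derivative^[s] (jacobiAtNegOne α β n)).eval (-1)
        / jacobiFunctional hα hβ (jacobiAtNegOne α β n * jacobiAtNegOne α β n))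
        / (n : ℝ) ^ (2 * β + 2 * (k : ℝ) + 2 * (s : ℝ) + 2 - 1)) atTop
      (nhds ((-1) ^ (k + s) / (2 ^ (α + β + (k : ℝ) + (s : ℝ))
        * Real.Gamma (β + k + 1) * Real.Gamma (β + s + 1)))) := by
  have hb : 0 < β + 1 := by linarith
  have hG := Real.Gamma_pos_of_pos hb
  have hA : ∀ k : ℕ, Tendsto (fun n : ℕ => (derivative^[k] (jacobiAtNegOne α β n)).eval (-1)
      / (n : ℝ) ^ (2 * k)) atTop
      (nhds ((-1) ^ k / ((ascPochhammer ℝ k).eval (β + 1) * 2 ^ k))) := by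
    intro k
    have h := ((tendsto_descFactorial_div_pow k).mul
      (tendsto_ascPochhammer_eval_div_pow (α + β + 1) k)).const_mul
      ((-1) ^ k / ((ascPochhammer ℝ k).eval (β + 1) * 2 ^ k))
    rw [mul_one, mul_one] at h
    refine h.congr fun n => ?_
    rw [iterate_derivative_jacobiAtNegOne_eval, two_mul, pow_add, div_mul_div_comm,
      div_mul_div_comm, ← mul_assoc, ← div_div]
  have h := ((hA k).mul (hA s)).div (tendsto_jacobiFunctional_jacobiAtNegOne_mul_self hα hβ)
    (by positivity)
  have hval : (-1) ^ k / ((ascPochhammer ℝ k).eval (β + 1) * 2 ^ k)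
      * ((-1) ^ s / ((ascPochhammer ℝ s).eval (β + 1) * 2 ^ s))
      / (2 ^ (α + β) * Real.Gamma (β + 1) ^ 2)
      = (-1) ^ (k + s) / (2 ^ (α + β + (k : ℝ) + (s : ℝ))
        * Real.Gamma (β + k + 1) * Real.Gamma (β + s + 1)) := by
    have hk := ascPochhammer_pos k _ hb
    have hs := ascPochhammer_pos s _ hb
    rw [add_right_comm β k, add_right_comm β s, Real.Gamma_add_natCast_eq_ascPochhammer_mul hb,
      Real.Gamma_add_natCast_eq_ascPochhammer_mul hb, Real.rpow_add_natCast two_ne_zero,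
      Real.rpow_add_natCast two_ne_zero, pow_add]
    field_simp
  rw [hval] at h
  refine h.congr' ?_
  filter_upwards [eventually_ne_atTop 0] with n hn
  have hn0 : (0 : ℝ) < n := by positivity
  simp only [Pi.div_apply]
  rw [show 2 * β + 2 * (k : ℝ) + 2 * (s : ℝ) + 2 - 1
      = 2 * β + 1 + (2 * k : ℕ) + (2 * s : ℕ) by push_cast; ring,
    Real.rpow_add_natCast hn0.ne', Real.rpow_add_natCast hn0.ne', div_mul_div_comm, div_div,
    div_div]
  congr 1
  ring

end

theorem cd_kernel_derivative_asymptotics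
    (α β : ℝ) (hα : -1 < α) (hβ : -1 < β) (k s : ℕ)
    (Pt : ℕ → ℝ[X])
    (hdeg : ∀ n, (Pt n).natDegree = n)
    (hone : ∀ n, (Pt n).eval 1 = 1)
    (horth : ∀ n k, k < n →
      ∫ x in Set.Ioo (-1 : ℝ) 1, (Pt n).eval x * x ^ k * (1 - x) ^ α * (1 + x) ^ β = 0)
    : Tendsto (fun n : ℕ =>
        (∑ m ∈ Finset.range n,
            ((⇑(derivative (R := ℝ)))^[k] (Pt m)).eval (-1)
              * ((⇑(derivative (R := ℝ)))^[s] (Pt m)).eval (-1)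
              / ∫ x in Set.Ioo (-1 : ℝ) 1, ((Pt m).eval x) ^ 2 * (1 - x) ^ α * (1 + x) ^ β)
          / (n : ℝ) ^ (2 * β + 2 * (k : ℝ) + 2 * (s : ℝ) + 2))
      atTop
      (nhds ((-1 : ℝ) ^ (k + s)
        / ((2 : ℝ) ^ (α + β + (k : ℝ) + (s : ℝ) + 1) * (β + k + s + 1)
            * Real.Gamma (β + k + 1) * Real.Gamma (β + s + 1)))) := by
  have hk : (0 : ℝ) ≤ k := k.cast_nonneg
  have hs : (0 : ℝ) ≤ s := s.cast_nonneg
  have hterm : ∀ m, ((⇑(derivative (R := ℝ)))^[k] (Pt m)).eval (-1)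
      * ((⇑(derivative (R := ℝ)))^[s] (Pt m)).eval (-1)
      / ∫ x in Set.Ioo (-1 : ℝ) 1, ((Pt m).eval x) ^ 2 * (1 - x) ^ α * (1 + x) ^ β
      = (derivative^[k] (jacobiAtNegOne α β m)).eval (-1)
        * (derivative^[s] (jacobiAtNegOne α β m)).eval (-1)
        / jacobiFunctional hα hβ (jacobiAtNegOne α β m * jacobiAtNegOne α β m) := by
    intro m
    have hne : Pt m ≠ 0 := fun h0 => by simpa [h0] using hone m
    obtain ⟨c, hc, hQ⟩ := jacobiAtNegOne_eq_C_mul hα hβ (hdeg m) hne fun j hj => by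
      rw [jacobiFunctional_apply, ← horth m j hj]
      simp only [eval_mul, eval_pow, eval_X, mul_assoc]
    rw [← ratio_eq_of_eq_C_mul (jacobiFunctional hα hβ) hc hQ, jacobiFunctional_apply]
    simp only [eval_mul, pow_two, mul_assoc]
  simp only [hterm]
  have h := tendsto_sum_range_div_rpow (q := 2 * β + 2 * (k : ℝ) + 2 * (s : ℝ) + 2)
    (by linarith) (tendsto_jacobi_kernel_term hα hβ k s)
  convert h using 2
  rw [Real.rpow_add_one two_ne_zero, div_div]
  congr 1
  ring
end
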